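/- The multiple polylogarithms are linearly independent over ℚ: the family of functions z ↦ Li_s(z) on the open real interval (0,1), indexed by all compositions s of positive integers together with the empty composition (whose polylogarithm is the constant function 1), is ℚ-linearly independent in the space of real-valued functions on (0,1). -/

import Mathlib

/-- The multiple polylogarithm `Li_{s_1,…,s_r}(z) = Σ_{n_1>…>n_r>0} z^{n_1}/(n_1^{s_1}⋯n_r^{s_r})`,
indexed by a list `(s_1,…,s_r)`; the polylogarithm of the empty composition is the
constant function `1`. -/
noncomputable def Li (l : List ℕ) (z : ℝ) : ℝ :=
  match l with
  | [] => 1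
  | s :: t =>
    ∑' f : {f : Fin (s :: t).length → ℕ // StrictAnti f ∧ ∀ i, 0 < f i},
      z ^ (f.1 ⟨0, Nat.succ_pos _⟩) * ∏ i, (1 : ℝ) / (f.1 i : ℝ) ^ ((s :: t).get i)

/-- The coefficient of `z ^ n` in the power series of the polylogarithm indexed by a list. -/
def polylogCoeff : List ℕ → ℕ → ℚ
  | [], n => if n = 0 then 1 else 0
  | a :: t, n => ((n : ℚ) ^ a)⁻¹ * ∑ k ∈ Finset.range n, polylogCoeff t k

/-- The truncated multiple harmonic sum, as a partial sum of polylogarithm coefficients. -/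
def harmonicSum (t : List ℕ) (n : ℕ) : ℚ := ∑ k ∈ Finset.range n, polylogCoeff t k

lemma polylogCoeff_cons (a : ℕ) (t : List ℕ) (n : ℕ) :
    polylogCoeff (a :: t) n = ((n : ℚ) ^ a)⁻¹ * harmonicSum t n := rfl

lemma harmonicSum_zero (t : List ℕ) : harmonicSum t 0 = 0 := by simp [harmonicSum]

lemma harmonicSum_nil {n : ℕ} (hn : 0 < n) : harmonicSum [] n = 1 := by
  simp [harmonicSum, polylogCoeff, hn]

lemma polylogCoeff_cons_zero (a : ℕ) (t : List ℕ) : polylogCoeff (a :: t) 0 = 0 := by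
  simp [polylogCoeff]

lemma harmonicSum_succ (t : List ℕ) (n : ℕ) :
    harmonicSum t (n + 1) = harmonicSum t n + polylogCoeff t n := by
  simp [harmonicSum, Finset.sum_range_succ]

section PowerSeries

open scoped ENNReal

/-- A sum over strictly decreasing tuples of positive integers, split by the first entry. -/
lemma tsum_strictAnti_succ {r : ℕ} (φ : Fin (r + 1) → ℕ → ℝ≥0∞) (b : ℕ∞) :
    ∑' f : {f : Fin (r + 1) → ℕ // StrictAnti f ∧ (∀ i, 0 < f i) ∧ ∀ i, (f i : ℕ∞) < b},
      ∏ i, φ i (f.1 i) =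
    ∑' k : ℕ, if 0 < k ∧ (k : ℕ∞) < b then
      φ 0 k * ∑' g : {g : Fin r → ℕ //
        StrictAnti g ∧ (∀ i, 0 < g i) ∧ ∀ i, (g i : ℕ∞) < (k : ℕ∞)}, ∏ i, φ i.succ (g.1 i)
      else 0 := by
  classical
  have hcond : ∀ (k : ℕ) (g : Fin r → ℕ),
      (StrictAnti (Fin.cons k g : Fin (r + 1) → ℕ) ∧
        (∀ i, 0 < (Fin.cons k g : Fin (r + 1) → ℕ) i) ∧
        ∀ i, (((Fin.cons k g : Fin (r + 1) → ℕ) i : ℕ) : ℕ∞) < b) ↔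
      (0 < k ∧ (k : ℕ∞) < b) ∧
        (StrictAnti g ∧ (∀ i, 0 < g i) ∧ ∀ i, (g i : ℕ∞) < (k : ℕ∞)) := by
    intro k g
    simp only [Fin.forall_fin_succ, Fin.cons_zero, Fin.cons_succ, Nat.cast_lt]
    constructor
    · rintro ⟨hs, ⟨hk, hg⟩, hkb, -⟩
      refine ⟨⟨hk, hkb⟩, fun i j hij => ?_, hg, fun i => ?_⟩
      · simpa using hs (Fin.succ_lt_succ_iff.2 hij)
      · simpa using hs (Fin.succ_pos i)
    · rintro ⟨⟨hk, hkb⟩, hs, hg, hgk⟩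
      refine ⟨fun i j hij => ?_, ⟨hk, hg⟩, hkb, fun i =>
        (Nat.cast_lt.2 (hgk i)).trans hkb⟩
      induction j using Fin.cases with
      | zero => exact absurd hij (Fin.not_lt_zero i)
      | succ j =>
        induction i using Fin.cases with
        | zero => simpa using hgk j
        | succ i => simpa using hs (Fin.succ_lt_succ_iff.1 hij)
  have hsub : ∀ {n : ℕ} (P : (Fin n → ℕ) → Prop) (F : (Fin n → ℕ) → ℝ≥0∞),
      ∑' f : {f // P f}, F f.1 = ∑' f, if P f then F f else 0 := by
    intro n P F
    exact (tsum_subtype {f | P f} F).trans (tsum_congr fun f => by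
      simp [Set.indicator_apply])
  rw [hsub _ (fun f : Fin (r + 1) → ℕ => ∏ i, φ i (f i)),
    ← (Fin.consEquiv (fun _ : Fin (r + 1) => ℕ)).tsum_eq, ENNReal.tsum_prod']
  refine tsum_congr fun k => ?_
  rw [hsub _ (fun g : Fin r → ℕ => ∏ i, φ i.succ (g i))]
  have hcond' := fun g : Fin r → ℕ => if_congr (hcond k g)
    (rfl : φ 0 k * ∏ i, φ (Fin.succ i) (g i) = _) (rfl : (0 : ℝ≥0∞) = 0)
  simp only [Fin.consEquiv_apply, Fin.prod_univ_succ, Fin.cons_zero, Fin.cons_succ]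
  refine (tsum_congr hcond').trans ?_
  split_ifs with hk
  · simp only [hk, true_and, ← ENNReal.tsum_mul_left, mul_ite, mul_zero]
  · exact ENNReal.tsum_eq_zero.2 fun g => if_neg fun h => hk h.1

lemma polylogCoeff_nonneg (l : List ℕ) (n : ℕ) : 0 ≤ polylogCoeff l n := by
  induction l generalizing n with
  | nil => rw [polylogCoeff]; split_ifs <;> norm_num
  | cons a t ih => exact mul_nonneg (by positivity) (Finset.sum_nonneg fun k _ => ih k)

lemma harmonicSum_nonneg (t : List ℕ) (n : ℕ) : 0 ≤ harmonicSum t n :=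
  Finset.sum_nonneg fun k _ => polylogCoeff_nonneg t k

lemma ofReal_polylogCoeff_cons (a : ℕ) (t : List ℕ) (n : ℕ) :
    ENNReal.ofReal (polylogCoeff (a :: t) n : ℝ) =
      ENNReal.ofReal (1 / (n : ℝ) ^ a) * ENNReal.ofReal (harmonicSum t n : ℝ) := by
  rw [← ENNReal.ofReal_mul (by positivity), polylogCoeff_cons]
  push_cast
  rw [one_div]

/-- `harmonicSum` is the sum over strictly decreasing tuples below `n`. -/
lemma tsum_strictAnti_eq_harmonicSum (t : List ℕ) {n : ℕ} (hn : 0 < n) :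
    ∑' g : {g : Fin t.length → ℕ //
        StrictAnti g ∧ (∀ i, 0 < g i) ∧ ∀ i, (g i : ℕ∞) < (n : ℕ∞)},
      ∏ i, ENNReal.ofReal (1 / (g.1 i : ℝ) ^ t.get i) =
    ENNReal.ofReal (harmonicSum t n : ℝ) := by
  induction t generalizing n with
  | nil =>
    rw [harmonicSum_nil hn, tsum_eq_single ⟨fun i => i.elim0, fun i => i.elim0,
      fun i => i.elim0, fun i => i.elim0⟩ fun g hg =>
        absurd (Subtype.ext (funext fun i => i.elim0)) hg]
    simp
  | cons a t ih =>
    refine (tsum_strictAnti_succ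
      (fun i k => ENNReal.ofReal (1 / (k : ℝ) ^ (a :: t).get i)) n).trans ?_
    rw [harmonicSum, Rat.cast_sum,
      ENNReal.ofReal_sum_of_nonneg fun k _ => by exact_mod_cast polylogCoeff_nonneg _ _,
      tsum_eq_sum (s := Finset.range n) fun k hk => if_neg fun h => hk (by simpa using h.2)]
    refine Finset.sum_congr rfl fun k hk => ?_
    rcases Nat.eq_zero_or_pos k with rfl | hk0
    · simp [polylogCoeff_cons_zero]
    · rw [if_pos ⟨hk0, by simpa using hk⟩, ofReal_polylogCoeff_cons, ← ih hk0]
      rfl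

/-- The power series expansion of a multiple polylogarithm. -/
lemma Li_eq_tsum_polylogCoeff (l : List ℕ) {z : ℝ} (hz : 0 ≤ z) :
    Li l z = ∑' n : ℕ, (polylogCoeff l n : ℝ) * z ^ n := by
  rcases l with _ | ⟨a, t⟩
  · rw [tsum_eq_single 0 fun n hn => by simp [polylogCoeff, hn]]
    simp [Li, polylogCoeff]
  have hφ := tsum_strictAnti_succ (r := t.length)
    (fun i k => Fin.cases (ENNReal.ofReal (z ^ k) * ENNReal.ofReal (1 / (k : ℝ) ^ a))
      (fun i => ENNReal.ofReal (1 / (k : ℝ) ^ t.get i)) i) ⊤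
  have hleft : (∑' f : {f : Fin (t.length + 1) → ℕ //
      StrictAnti f ∧ (∀ i, 0 < f i) ∧ ∀ i, (f i : ℕ∞) < ⊤},
      ∏ i : Fin (t.length + 1), (Fin.cases (ENNReal.ofReal (z ^ f.1 i) *
          ENNReal.ofReal (1 / (f.1 i : ℝ) ^ a))
        (fun i' => ENNReal.ofReal (1 / (f.1 i : ℝ) ^ t.get i')) i : ℝ≥0∞)).toReal =
      Li (a :: t) z := by
    rw [ENNReal.tsum_toReal_eq fun f => ENNReal.prod_ne_top fun i _ => by
      induction i using Fin.cases with
      | zero => exact ENNReal.mul_ne_top ENNReal.ofReal_ne_top ENNReal.ofReal_ne_top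
      | succ i => exact ENNReal.ofReal_ne_top]
    let e : {f : Fin (t.length + 1) → ℕ //
        StrictAnti f ∧ (∀ i, 0 < f i) ∧ ∀ i, (f i : ℕ∞) < ⊤} ≃
        {f : Fin (a :: t).length → ℕ // StrictAnti f ∧ ∀ i, 0 < f i} :=
      Equiv.subtypeEquivRight fun f => by simp [ENat.natCast_lt_top]
    rw [Li]
    refine Eq.trans ?_ (e.tsum_eq _)
    refine tsum_congr fun f => ?_
    rw [ENNReal.toReal_prod]
    refine (Fin.prod_univ_succ _).trans ?_
    refine Eq.trans ?_ (congrArg _ (Fin.prod_univ_succ _).symm)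
    simp only [Fin.cases_zero, Fin.cases_succ, ENNReal.toReal_mul]
    rw [ENNReal.toReal_ofReal (by positivity), ENNReal.toReal_ofReal (by positivity), mul_assoc]
    refine congrArg _ (congrArg _ (Finset.prod_congr rfl fun i _ => ?_))
    rw [ENNReal.toReal_ofReal (by positivity)]
    rfl
  rw [← hleft, hφ, ENNReal.tsum_toReal_eq]
  · refine tsum_congr fun k => ?_
    rcases Nat.eq_zero_or_pos k with rfl | hk
    · simp [polylogCoeff_cons_zero]
    rw [if_pos ⟨hk, ENat.natCast_lt_top k⟩]
    simp only [Fin.cases_zero, Fin.cases_succ]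
    rw [tsum_strictAnti_eq_harmonicSum t hk, mul_assoc, ← ofReal_polylogCoeff_cons,
      ENNReal.toReal_mul, ENNReal.toReal_ofReal (by positivity),
      ENNReal.toReal_ofReal (by exact_mod_cast polylogCoeff_nonneg _ _), mul_comm]
  · intro k
    split_ifs with hk
    · simp only [Fin.cases_zero, Fin.cases_succ]
      rw [tsum_strictAnti_eq_harmonicSum t hk.1, mul_assoc, ← ofReal_polylogCoeff_cons]
      exact ENNReal.mul_ne_top ENNReal.ofReal_ne_top ENNReal.ofReal_ne_top
    · exact ENNReal.zero_ne_top

lemma polylogCoeff_le_pow (l : List ℕ) (n : ℕ) : polylogCoeff l n ≤ ((n : ℚ) + 1) ^ l.length := by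
  induction l generalizing n with
  | nil => rw [polylogCoeff]; split_ifs <;> simp
  | cons a t ih =>
    rcases Nat.eq_zero_or_pos n with rfl | hn
    · rw [polylogCoeff_cons_zero]; positivity
    have hinv : ((n : ℚ) ^ a)⁻¹ ≤ 1 :=
      inv_le_one_of_one_le₀ (one_le_pow₀ (by exact_mod_cast hn))
    have hsum : harmonicSum t n ≤ n * ((n : ℚ) + 1) ^ t.length := by
      have := Finset.sum_le_card_nsmul (Finset.range n) (polylogCoeff t)
        (((n : ℚ) + 1) ^ t.length) fun k hk => (ih k).trans (by
          have : k ≤ n := (Finset.mem_range.1 hk).le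
          gcongr)
      simpa [harmonicSum] using this
    calc polylogCoeff (a :: t) n ≤ 1 * harmonicSum t n :=
          mul_le_mul_of_nonneg_right hinv (harmonicSum_nonneg t n)
      _ ≤ n * ((n : ℚ) + 1) ^ t.length := by rwa [one_mul]
      _ ≤ ((n : ℚ) + 1) ^ (a :: t).length := by
          rw [List.length_cons, pow_succ']
          gcongr
          linarith

lemma summable_polylogCoeff (l : List ℕ) {z : ℝ} (hz : 0 < z) (hz1 : z < 1) :
    Summable fun n : ℕ => (polylogCoeff l n : ℝ) * z ^ n := by
  have hs : Summable fun n : ℕ => ((n + 1 : ℕ) : ℝ) ^ l.length * z ^ (n + 1) := by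
    have hs := summable_pow_mul_geometric_of_norm_lt_one l.length
      (show ‖z‖ < 1 by rwa [Real.norm_of_nonneg hz.le])
    exact (summable_nat_add_iff (f := fun n : ℕ => (n : ℝ) ^ l.length * z ^ n) 1).2 hs
  refine Summable.of_nonneg_of_le (fun n => ?_) (fun n => ?_) (hs.mul_left z⁻¹)
  · have : (0 : ℝ) ≤ polylogCoeff l n := by exact_mod_cast polylogCoeff_nonneg l n
    positivity
  · have h : (polylogCoeff l n : ℝ) ≤ ((n + 1 : ℕ) : ℝ) ^ l.length := by
      exact_mod_cast polylogCoeff_le_pow l n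
    calc (polylogCoeff l n : ℝ) * z ^ n ≤ ((n + 1 : ℕ) : ℝ) ^ l.length * z ^ n := by gcongr
      _ = z⁻¹ * (((n + 1 : ℕ) : ℝ) ^ l.length * z ^ (n + 1)) := by
        field_simp
        rw [pow_succ]

/-- A power series that converges to zero on `(0, 1)` has vanishing coefficients. -/
lemma eq_zero_of_hasSum_zero (b : ℕ → ℝ)
    (h : ∀ z : ℝ, 0 < z → z < 1 → HasSum (fun n => b n * z ^ n) 0) : b = 0 := by
  by_contra hb
  let P := FormalMultilinearSeries.ofScalars ℝ b
  have hrad : 0 < P.radius := by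
    refine lt_of_lt_of_le (ENNReal.coe_pos.2 (show (0 : NNReal) < 1 / 2 by norm_num))
      (P.le_radius_of_tendsto (l := 0) ?_)
    have := (h (1 / 2) (by norm_num) (by norm_num)).summable.tendsto_atTop_zero.norm
    simpa [P, FormalMultilinearSeries.ofScalars_norm] using this
  have hP : P ≠ 0 := fun h0 => hb ((FormalMultilinearSeries.ofScalars_series_eq_zero ℝ).1 h0)
  have hne := (P.hasFPowerSeriesOnBall hrad).hasFPowerSeriesAt.locally_ne_zero hP
  have hne' : ∀ᶠ z in nhdsWithin (0 : ℝ) (Set.Ioi 0), P.sum z ≠ 0 :=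
    hne.filter_mono (nhdsWithin_mono 0 fun z hz => ne_of_gt hz)
  obtain ⟨z, hz, hz0, hz1⟩ := (hne'.and (Ioo_mem_nhdsGT (zero_lt_one' ℝ))).exists
  refine hz ?_
  have : P.sum z = ∑' n, b n * z ^ n := by
    simp [P, FormalMultilinearSeries.sum, mul_comm]
  rw [this, (h z hz0 hz1).tsum_eq]

end PowerSeries

section PadicEstimates

variable {p : ℕ} [hp : Fact p.Prime]

lemma padicNorm_natCast_eq_one_of_lt {k : ℕ} (hk : 0 < k) (hkp : k < p) :
    padicNorm p (k : ℚ) = 1 :=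
  padicNorm.nat_eq_one_iff k |>.2 (Nat.not_dvd_of_pos_of_lt hk hkp)

lemma padicNorm_inv_pow_mul {x : ℚ} (hx : padicNorm p x = 1) (a : ℕ) (y : ℚ) :
    padicNorm p ((x ^ a)⁻¹ * y) = padicNorm p y := by
  rw [padicNorm.mul, IsAbsoluteValue.abv_inv (padicNorm p), IsAbsoluteValue.abv_pow (padicNorm p),
    hx, one_pow, inv_one, one_mul]

lemma padicNorm_pow_mul_lt_one {a : ℕ} (ha : 0 < a) {x : ℚ} (hx : padicNorm p x ≤ 1) :
    padicNorm p ((p : ℚ) ^ a * x) < 1 := by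
  rw [padicNorm.mul, IsAbsoluteValue.abv_pow (padicNorm p)]
  exact mul_lt_one_of_nonneg_of_lt_one_left (pow_nonneg (padicNorm.nonneg _) _)
    (pow_lt_one₀ (padicNorm.nonneg _) padicNorm.padicNorm_p_lt_one_of_prime ha.ne') hx

lemma padicNorm_add_lt_one {x y : ℚ} (hx : padicNorm p x < 1) (hy : padicNorm p y < 1) :
    padicNorm p (x + y) < 1 :=
  padicNorm.nonarchimedean.trans_lt (max_lt hx hy)

lemma padicNorm_le_one_of_sub_lt {x y : ℚ} (h : padicNorm p (x - y) < 1)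
    (hy : padicNorm p y ≤ 1) : padicNorm p x ≤ 1 := by
  have := padicNorm.nonarchimedean (p := p) (q := x - y) (r := y)
  rw [sub_add_cancel] at this
  exact this.trans (max_le h.le hy)

lemma padicNorm_harmonicSum_le_one (t : List ℕ) {n : ℕ} (hn : n ≤ p) :
    padicNorm p (harmonicSum t n) ≤ 1 := by
  induction t generalizing n with
  | nil =>
    rcases Nat.eq_zero_or_pos n with rfl | h
    · simp [harmonicSum_zero]
    · simp [harmonicSum_nil h]
  | cons a t ih =>
    refine padicNorm.sum_le' (fun k hk => ?_) zero_le_one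
    rw [polylogCoeff_cons]
    rcases Nat.eq_zero_or_pos k with rfl | h
    · simp [harmonicSum_zero]
    have hkp : k < p := (Finset.mem_range.1 hk).trans_le hn
    rw [padicNorm_inv_pow_mul (padicNorm_natCast_eq_one_of_lt h hkp)]
    exact ih hkp.le

/-- Splitting a sum over `k < p * m + j` according to whether `p` divides `k`. -/
lemma sum_range_mul_add_eq (f : ℕ → ℚ) {m j : ℕ} (hj : 0 < j) (hjp : j ≤ p) :
    ∑ k ∈ Finset.range (p * m + j), f k = ∑ i ∈ Finset.range (m + 1), f (p * i) +
      ∑ k ∈ (Finset.range (p * m + j)).filter (fun k => ¬ p ∣ k), f k := by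
  have hp0 : 0 < p := hp.out.pos
  rw [← Finset.sum_filter_add_sum_filter_not (Finset.range (p * m + j)) (fun k => p ∣ k)]
  congr 1
  symm
  refine Finset.sum_bij (fun i _ => p * i) ?_ ?_ ?_ (fun _ _ => rfl)
  · intro i hi
    have : p * i ≤ p * m := Nat.mul_le_mul_left p (Nat.lt_succ_iff.1 (Finset.mem_range.1 hi))
    simp only [Finset.mem_filter, Finset.mem_range, dvd_mul_right, and_true]
    omega
  · intro i _ k _ h
    exact Nat.eq_of_mul_eq_mul_left hp0 h
  · intro k hk
    obtain ⟨hk, i, rfl⟩ := by simpa only [Finset.mem_filter, Finset.mem_range] using hk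
    refine ⟨i, ?_, rfl⟩
    rw [Finset.mem_range]
    by_contra! h
    have := Nat.mul_le_mul_left p h
    rw [mul_add, mul_one] at this
    omega

/-- The leading `p`-adic behaviour of a truncated multiple harmonic sum. -/
lemma padicNorm_harmonicSum_sub_lt_one (t : List ℕ) (ht : ∀ x ∈ t, 0 < x) {m j : ℕ} (hm : m < p)
    (hj : 0 < j) (hjp : j ≤ p) :
    padicNorm p ((p : ℚ) ^ t.sum * harmonicSum t (p * m + j) - harmonicSum t (m + 1)) < 1 := by
  induction t generalizing m j with
  | nil => simp [harmonicSum_nil, hj]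
  | cons a t ih =>
    have ha : 0 < a := ht a (by simp)
    have ht' : ∀ x ∈ t, 0 < x := fun x hx => ht x (by simp [hx])
    have hp0 : (p : ℚ) ≠ 0 := by exact_mod_cast hp.out.ne_zero
    rw [harmonicSum, harmonicSum, sum_range_mul_add_eq _ hj hjp, mul_add, add_sub_right_comm,
      Finset.mul_sum, ← Finset.sum_sub_distrib, Finset.mul_sum]
    refine padicNorm_add_lt_one (padicNorm.sum_lt' (fun i hi => ?_) one_pos)
      (padicNorm.sum_lt' (fun k hk => ?_) one_pos)
    · rcases i with _ | i
      · simp [polylogCoeff_cons_zero]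
      have hi : i < m := by simpa using hi
      have key : (p : ℚ) ^ (a :: t).sum * polylogCoeff (a :: t) (p * (i + 1)) -
          polylogCoeff (a :: t) (i + 1) = (((i + 1 : ℕ) : ℚ) ^ a)⁻¹ *
            ((p : ℚ) ^ t.sum * harmonicSum t (p * i + p) - harmonicSum t (i + 1)) := by
        rw [polylogCoeff_cons, polylogCoeff_cons, List.sum_cons, pow_add, mul_add_one]
        have : ((p * i + p : ℕ) : ℚ) = p * ((i + 1 : ℕ) : ℚ) := by push_cast; ring
        rw [this, mul_pow]
        have : ((i + 1 : ℕ) : ℚ) ≠ 0 := by positivity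
        field_simp
      rw [key, padicNorm_inv_pow_mul (padicNorm_natCast_eq_one_of_lt i.succ_pos (by omega))]
      exact ih ht' (hi.trans hm) hp.out.pos le_rfl
    · simp only [Finset.mem_filter, Finset.mem_range] at hk
      have hkmod : 0 < k % p := Nat.pos_of_ne_zero fun h => hk.2 (Nat.dvd_of_mod_eq_zero h)
      have hkdiv : k / p < p := by
        refine (Nat.lt_succ_iff.1 ((Nat.div_lt_iff_lt_mul hp.out.pos).2 ?_)).trans_lt hm
        rw [Nat.succ_mul, mul_comm]
        omega
      have h1 := padicNorm_le_one_of_sub_lt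
        (ih ht' hkdiv hkmod (Nat.mod_lt k hp.out.pos).le) (padicNorm_harmonicSum_le_one t hkdiv)
      rw [Nat.div_add_mod] at h1
      have key : (p : ℚ) ^ (a :: t).sum * polylogCoeff (a :: t) k =
          p ^ a * (((k : ℚ) ^ a)⁻¹ * (p ^ t.sum * harmonicSum t k)) := by
        rw [polylogCoeff_cons, List.sum_cons, pow_add]
        ring
      rw [key]
      refine padicNorm_pow_mul_lt_one ha ?_
      rwa [padicNorm_inv_pow_mul (padicNorm.nat_eq_one_iff k |>.2 hk.2)]

/-- The leading `p`-adic behaviour of a polylogarithm coefficient at an index prime to `p`. -/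
lemma padicNorm_polylogCoeff_sub_lt_one (a : ℕ) (t : List ℕ) (ht : ∀ x ∈ t, 0 < x) {m j : ℕ}
    (hm : m < p) (hj : 0 < j) (hjp : j < p) :
    padicNorm p ((p : ℚ) ^ t.sum * polylogCoeff (a :: t) (p * m + j) -
      ((j : ℚ) ^ a)⁻¹ * harmonicSum t (m + 1)) < 1 := by
  have hj1 : padicNorm p (j : ℚ) = 1 := padicNorm_natCast_eq_one_of_lt hj hjp
  have hdvd : ¬ p ∣ p * m + j := fun h =>
    Nat.not_dvd_of_pos_of_lt hj hjp ((Nat.dvd_add_right (dvd_mul_right p m)).1 h)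
  have hk1 : padicNorm p ((p * m + j : ℕ) : ℚ) = 1 := (padicNorm.nat_eq_one_iff _).2 hdvd
  have hj0 : (j : ℚ) ^ a ≠ 0 := by positivity
  have hk0 : ((p * m + j : ℕ) : ℚ) ^ a ≠ 0 := by positivity
  have key : (p : ℚ) ^ t.sum * polylogCoeff (a :: t) (p * m + j) -
      ((j : ℚ) ^ a)⁻¹ * harmonicSum t (m + 1) =
      (((p * m + j : ℕ) : ℚ) ^ a)⁻¹ *
        (p ^ t.sum * harmonicSum t (p * m + j) - harmonicSum t (m + 1)) +
      (((p * m + j : ℕ) : ℚ) ^ a)⁻¹ * (((j : ℚ) ^ a)⁻¹ *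
        (-(((p * m + j : ℕ) : ℚ) ^ a - (j : ℚ) ^ a) * harmonicSum t (m + 1))) := by
    rw [polylogCoeff_cons]
    field_simp
    ring
  rw [key]
  refine padicNorm_add_lt_one ?_ ?_
  · rw [padicNorm_inv_pow_mul hk1]
    exact padicNorm_harmonicSum_sub_lt_one t ht hm hj hjp.le
  · rw [padicNorm_inv_pow_mul hk1, padicNorm_inv_pow_mul hj1, padicNorm.mul, padicNorm.neg]
    refine mul_lt_one_of_nonneg_of_lt_one_left (padicNorm.nonneg _) ?_
      (padicNorm_harmonicSum_le_one t hm)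
    have hdiv : (p : ℤ) ∣ ((p * m + j : ℕ) : ℤ) ^ a - (j : ℤ) ^ a :=
      Dvd.dvd.trans ⟨m, by push_cast; ring⟩ (sub_dvd_pow_sub_pow _ _ a)
    have := (padicNorm.int_lt_one_iff _).2 hdiv
    exact_mod_cast this

end PadicEstimates

lemma eventually_padicNorm_eq_one {x : ℚ} (hx : x ≠ 0) :
    ∀ᶠ p : ℕ in Filter.atTop, p.Prime → padicNorm p x = 1 := by
  filter_upwards [Filter.eventually_gt_atTop x.den, Filter.eventually_gt_atTop x.num.natAbs]
    with p hden hnum hp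
  have : Fact p.Prime := ⟨hp⟩
  have h1 : padicNorm p (x.num : ℚ) = 1 := by
    rw [padicNorm.int_eq_one_iff, Int.natCast_dvd]
    exact Nat.not_dvd_of_pos_of_lt (Int.natAbs_pos.2 (Rat.num_ne_zero.2 hx)) hnum
  rw [← Rat.num_div_den x, padicNorm.div, h1, padicNorm_natCast_eq_one_of_lt x.den_pos hden,
    div_one]

lemma eventually_padicNorm_le_one (x : ℚ) :
    ∀ᶠ p : ℕ in Filter.atTop, p.Prime → padicNorm p x ≤ 1 := by
  rcases eq_or_ne x 0 with rfl | hx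
  · simp
  · exact (eventually_padicNorm_eq_one hx).mono fun p h hp => (h hp).le

lemma eq_zero_of_eventually_padicNorm_lt_one {x : ℚ}
    (h : ∀ᶠ p : ℕ in Filter.atTop, p.Prime → padicNorm p x < 1) : x = 0 := by
  by_contra hx
  obtain ⟨N, hN⟩ := Filter.eventually_atTop.1 (h.and (eventually_padicNorm_eq_one hx))
  obtain ⟨p, hpN, hp⟩ := Nat.exists_infinite_primes N
  exact ((hN p hpN).1 hp).ne ((hN p hpN).2 hp)

/-- In a linear relation between polylogarithm coefficients, the part whose tails have maximal
weight yields relations between truncated multiple harmonic sums. -/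
lemma sum_inv_pow_mul_harmonicSum_eq_zero (S : Finset (List ℕ)) (c : List ℕ → ℚ) (W : ℕ)
    (hpos : ∀ l ∈ S, ∀ x ∈ l, 0 < x) (hne : ∀ l ∈ S, l ≠ []) (hW : ∀ l ∈ S, l.tail.sum ≤ W)
    (h : ∀ n, ∑ l ∈ S, c l * polylogCoeff l n = 0) (m : ℕ) {j : ℕ} (hj : 0 < j) :
    ∑ l ∈ S with l.tail.sum = W,
      c l * (((j : ℚ) ^ l.headI)⁻¹ * harmonicSum l.tail (m + 1)) = 0 := by
  apply eq_zero_of_eventually_padicNorm_lt_one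
  have hc : ∀ᶠ p : ℕ in Filter.atTop, ∀ l ∈ S, p.Prime → padicNorm p (c l) ≤ 1 :=
    (Filter.eventually_all_finset S).2 fun l _ => eventually_padicNorm_le_one (c l)
  filter_upwards [hc, Filter.eventually_gt_atTop m, Filter.eventually_gt_atTop j]
    with p hc hm hjp hp
  have : Fact p.Prime := ⟨hp⟩
  have key : ∑ l ∈ S with l.tail.sum = W,
      c l * (((j : ℚ) ^ l.headI)⁻¹ * harmonicSum l.tail (m + 1)) =
      ∑ l ∈ S, -(c l * ((p : ℚ) ^ W * polylogCoeff l (p * m + j) - if l.tail.sum = W then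
        ((j : ℚ) ^ l.headI)⁻¹ * harmonicSum l.tail (m + 1) else 0)) := by
    have h0 : ∑ l ∈ S, c l * ((p : ℚ) ^ W * polylogCoeff l (p * m + j)) = 0 := by
      rw [← mul_zero ((p : ℚ) ^ W), ← h (p * m + j), Finset.mul_sum]
      exact Finset.sum_congr rfl fun l _ => by ring
    rw [Finset.sum_neg_distrib, Finset.sum_congr rfl fun l _ => mul_sub _ _ _,
      Finset.sum_sub_distrib, h0, zero_sub, neg_neg, Finset.sum_filter]
    exact Finset.sum_congr rfl fun l _ => by split_ifs <;> simp
  rw [key]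
  refine padicNorm.sum_lt' (fun l hl => ?_) one_pos
  rw [padicNorm.neg, padicNorm.mul]
  refine mul_lt_one_of_nonneg_of_lt_one_right (hc l hl hp) (padicNorm.nonneg _) ?_
  have hl0 := hne l hl
  have hlW := hW l hl
  have hlp := hpos l hl
  rcases l with _ | ⟨a, t⟩
  · exact absurd rfl hl0
  have ht : ∀ x ∈ t, 0 < x := fun x hx => hlp x (by simp [hx])
  have hmain := padicNorm_polylogCoeff_sub_lt_one a t ht hm hj hjp
  rcases eq_or_ne (a :: t).tail.sum W with hw | hw
  · rw [if_pos hw, ← hw]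
    exact hmain
  · simp only [List.tail_cons] at hlW
    rw [if_neg hw, sub_zero, ← Nat.sub_add_cancel hlW, pow_add, mul_assoc]
    rw [List.tail_cons] at hw
    refine padicNorm_pow_mul_lt_one (by omega) (padicNorm_le_one_of_sub_lt hmain ?_)
    rw [padicNorm_inv_pow_mul (padicNorm_natCast_eq_one_of_lt hj hjp)]
    exact padicNorm_harmonicSum_le_one t hm

/-- Distinct powers of the sequence `1 / j` are linearly independent. -/
lemma sum_filter_eq_zero_of_sum_inv_pow {ι : Type*} (S : Finset ι) (d : ι → ℚ) (e : ι → ℕ)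
    (h : ∀ j : ℕ, 0 < j → ∑ i ∈ S, d i * ((j : ℚ) ^ e i)⁻¹ = 0) (a : ℕ) :
    ∑ i ∈ S with e i = a, d i = 0 := by
  let P : Polynomial ℚ := ∑ i ∈ S, Polynomial.monomial (e i) (d i)
  have hP : P = 0 := by
    apply Polynomial.eq_zero_of_infinite_isRoot
    refine Set.Infinite.mono ?_ (Set.infinite_range_of_injective
      (f := fun j : ℕ => ((j + 1 : ℕ) : ℚ)⁻¹) ?_)
    · rintro _ ⟨j, rfl⟩
      simp only [Set.mem_ofPred_eq, Polynomial.IsRoot, P, Polynomial.eval_finsetSum,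
        Polynomial.eval_monomial, inv_pow]
      exact h (j + 1) j.succ_pos
    · intro i j hij
      simpa using hij
  have := congrArg (fun Q => Polynomial.coeff Q a) hP
  simpa [P, Polynomial.finsetSum_coeff, Polynomial.coeff_monomial, Finset.sum_filter] using this

/-- The coefficient sequences of the polylogarithms are linearly independent over `ℚ`. -/
lemma eq_zero_of_sum_polylogCoeff_eq_zero (N : ℕ) (S : Finset (List ℕ)) (c : List ℕ → ℚ)
    (hpos : ∀ l ∈ S, ∀ x ∈ l, 0 < x) (hN : ∀ l ∈ S, l.sum < N)
    (h : ∀ n, ∑ l ∈ S, c l * polylogCoeff l n = 0) : ∀ l ∈ S, c l = 0 := by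
  induction N generalizing S c with
  | zero => exact fun l hl => absurd (hN l hl) (Nat.not_lt_zero _)
  | succ N ih =>
    by_contra! hcon
    obtain ⟨l₁, hl₁, hc₁⟩ := hcon
    set T := S.filter (fun l => c l ≠ 0) with hT
    have hTS : T ⊆ S := Finset.filter_subset _ _
    have hTsum : ∀ n, ∑ l ∈ T, c l * polylogCoeff l n = 0 := fun n => by
      rw [← h n, hT, Finset.sum_filter]
      exact Finset.sum_congr rfl fun l _ => by split_ifs with hl <;> simp_all
    have hne : ∀ l ∈ T, l ≠ [] := by
      rintro l hl rfl
      have h0 := hTsum 0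
      rw [Finset.sum_eq_single_of_mem [] hl] at h0
      · exact (Finset.mem_filter.1 hl).2 (by simpa [polylogCoeff] using h0)
      · rintro (_ | ⟨a, t⟩) _ hb
        · exact absurd rfl hb
        · rw [polylogCoeff_cons_zero, mul_zero]
    obtain ⟨l₀, hl₀, hmax⟩ := Finset.exists_max_image T (fun l => l.tail.sum)
      ⟨l₁, Finset.mem_filter.2 ⟨hl₁, hc₁⟩⟩
    rcases l₀ with _ | ⟨a, t⟩
    · exact hne _ hl₀ rfl
    have ha : 0 < a := hpos _ (hTS hl₀) a (by simp)
    have hsum : a + t.sum < N + 1 := by simpa using hN _ (hTS hl₀)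
    set U := (T.filter (fun l => l.tail.sum = t.sum)).filter (fun l => l.headI = a) with hU
    have hUcons : ∀ l ∈ U, l = a :: l.tail := by
      intro l hl
      simp only [hU, Finset.mem_filter] at hl
      rcases l with _ | ⟨b, u⟩
      · exact absurd rfl (hne _ hl.1.1)
      · simpa using hl.2
    have hUT : ∀ l ∈ U, l ∈ T ∧ l.tail.sum = t.sum := fun l hl => by
      simp only [hU, Finset.mem_filter] at hl
      exact hl.1
    have hharm : ∀ m, ∑ l ∈ U, c l * harmonicSum l.tail (m + 1) = 0 := by
      intro m
      refine sum_filter_eq_zero_of_sum_inv_pow _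
        (fun l : List ℕ => c l * harmonicSum l.tail (m + 1)) List.headI (fun j hj => ?_) a
      rw [← sum_inv_pow_mul_harmonicSum_eq_zero T c t.sum (fun l hl => hpos l (hTS hl)) hne
        hmax hTsum m hj]
      exact Finset.sum_congr rfl fun l _ => by ring
    have hcoeff : ∀ n, ∑ l ∈ U, c l * polylogCoeff l.tail n = 0 := by
      intro n
      rcases n with _ | n
      · simpa [harmonicSum_succ, harmonicSum_zero] using hharm 0
      · have := hharm (n + 1)
        simp only [harmonicSum_succ _ (n + 1), mul_add, Finset.sum_add_distrib, hharm n,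
          zero_add] at this
        exact this
    have hinj : Set.InjOn List.tail (U : Set (List ℕ)) := fun l hl l' hl' hll => by
      rw [hUcons l hl, hUcons l' hl', hll]
    have hzero := ih (U.image List.tail) (fun u => c (a :: u)) ?_ ?_ ?_ t
      (Finset.mem_image.2 ⟨a :: t, by simp [hU, hl₀], rfl⟩)
    · exact (Finset.mem_filter.1 hl₀).2 hzero
    · simp only [Finset.mem_image, forall_exists_index, and_imp]
      rintro _ l hl rfl x hx
      exact hpos l (hTS (hUT l hl).1) x (List.mem_of_mem_tail hx)
    · simp only [Finset.mem_image, forall_exists_index, and_imp]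
      rintro _ l hl rfl
      rw [(hUT l hl).2]
      omega
    · intro n
      rw [Finset.sum_image hinj, ← hcoeff n]
      exact Finset.sum_congr rfl fun l hl => by rw [← hUcons l hl]

/-- the multiple polylogarithms `z ↦ Li_s(z)` on the open interval `(0,1)`,
indexed by all compositions of positive integers together with the empty composition,
form a ℚ-linearly independent family in the space of real-valued functions on `(0,1)`. -/
theorem polylogarithms_linearIndependent :
    LinearIndependent ℚ
      (fun l : {l : List ℕ // ∀ x ∈ l, 0 < x} =>
        (fun z : Set.Ioo (0 : ℝ) 1 => Li l.1 z)) := by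
  classical
  rw [linearIndependent_iff']
  intro S g hg l hl
  let c : List ℕ → ℚ := fun l => if h : ∀ x ∈ l, 0 < x then g ⟨l, h⟩ else 0
  have hc : ∀ l : {l : List ℕ // ∀ x ∈ l, 0 < x}, c l.1 = g l := fun l => dif_pos l.2
  have hrel : (fun n => ∑ l ∈ S, (g l : ℝ) * (polylogCoeff l.1 n : ℝ)) = 0 := by
    refine eq_zero_of_hasSum_zero _ fun z hz hz1 => ?_
    have hz0 := congrFun hg ⟨z, hz, hz1⟩
    simp only [Finset.sum_apply, Pi.smul_apply, Pi.zero_apply, Rat.smul_def] at hz0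
    rw [← hz0]
    simp only [Finset.sum_mul, mul_assoc]
    refine hasSum_sum fun l _ => HasSum.mul_left _ ?_
    rw [Li_eq_tsum_polylogCoeff l.1 hz.le]
    exact (summable_polylogCoeff l.1 hz hz1).hasSum
  rw [← hc l]
  refine eq_zero_of_sum_polylogCoeff_eq_zero (S.sup (fun l => l.1.sum) + 1)
    (S.image Subtype.val) c ?_ ?_ ?_ l.1 (Finset.mem_image_of_mem _ hl)
  · simp only [Finset.mem_image, forall_exists_index, and_imp]
    rintro _ l _ rfl
    exact l.2
  · simp only [Finset.mem_image, forall_exists_index, and_imp]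
    rintro _ l hl rfl
    exact Nat.lt_succ_of_le (Finset.le_sup (f := fun l : {l : List ℕ // ∀ x ∈ l, 0 < x} =>
      l.1.sum) hl)
  · intro n
    rw [Finset.sum_image Subtype.val_injective.injOn]
    simp only [hc]
    have hn := congrFun hrel n
    rw [Pi.zero_apply] at hn
    exact_mod_cast hn
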